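/- Let ℚ[κ₁, κ₂, κ₃, …] be the polynomial ring over ℚ in countably many variables. For positive integers a_1, …, a_p define R(a_1, …, a_p) = Σ_{σ ∈ S_p} ∏_{c} κ_{Σ_{j∈c} a_j}, where the sum is over all permutations σ of {1,…,p} and the product is over the disjoint cycles c of σ (each element of {1,…,p} lying in exactly one cycle, fixed points included). Then for all positive integers a_1, …, a_p: κ_{a_1}·κ_{a_2}⋯κ_{a_p} = Σ_{k=1}^p [(−1)^{p−k}/k!]·Σ_{(S_1,…,S_k)} R(Σ_{j∈S_1} a_j, …, Σ_{j∈S_k} a_j), where the inner sum is over all ordered k-tuples (S_1, …, S_k) of pairwise disjoint nonempty subsets of {1,…,p} whose union is {1,…,p}. -/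

import Mathlib

open MvPolynomial

/-- `kmzR p a = R(a_1, …, a_p) = Σ_{σ ∈ S_p} ∏_{cycles c of σ} κ_{Σ_{j ∈ c} a_j}`,
an element of the polynomial ring `ℚ[κ₀, κ₁, κ₂, …]` (only the variables `κ_i` with
`i ≥ 1` occur when all `a_j` are positive).  The product is over all cycles of `σ`,
fixed points included: nontrivial cycles are the cycle factors of `σ` and each fixed
point `j` contributes a factor `κ_{a_j}`. -/
noncomputable def kmzR (p : ℕ) (a : Fin p → ℕ) : MvPolynomial ℕ ℚ :=
  ∑ σ : Equiv.Perm (Fin p),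
    (∏ c ∈ σ.cycleFactorsFinset, X (∑ j ∈ c.support, a j)) *
      ∏ j ∈ Finset.univ.filter (fun j => σ j = j), X (a j)

/-- weight of a permutation -/
noncomputable def kmzW {α : Type} [Fintype α] [DecidableEq α] (σ : Equiv.Perm α) (a : α → ℕ) :
    MvPolynomial ℕ ℚ :=
  (∏ c ∈ σ.cycleFactorsFinset, X (∑ j ∈ c.support, a j)) *
      ∏ j ∈ Finset.univ.filter (fun j => σ j = j), X (a j)

/-- `R` over a general finite type -/
noncomputable def kmzRR (α : Type) [Fintype α] [DecidableEq α] (a : α → ℕ) :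
    MvPolynomial ℕ ℚ := ∑ σ : Equiv.Perm α, kmzW σ a

theorem kmzW_eq {α β : Type} [Fintype α] [DecidableEq α] [DecidableEq β]
    (σ : Equiv.Perm α) (a : α → ℕ) (f : α → β) (hf : ∀ x y, f x = f y ↔ σ.SameCycle x y) :
    kmzW σ a = ∏ b ∈ Finset.univ.image f, X (∑ j with f j = b, a j) := by
  have hU : (Finset.univ.image f) = σ.support.image f ∪
      (Finset.univ.filter (fun j => σ j = j)).image f := by
    rw [← Finset.image_union]
    congr 1
    ext x
    simp [Equiv.Perm.mem_support, em']
  have hfix : ∀ x y, σ x = x → f y = f x → y = x := by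
    intro x y hx h
    have := (hf y x).1 h
    exact (this.symm.eq_of_left hx).symm
  have hD : Disjoint (σ.support.image f) ((Finset.univ.filter (fun j => σ j = j)).image f) := by
    rw [Finset.disjoint_left]
    intro b h1 h2
    simp only [Finset.mem_image, Equiv.Perm.mem_support, Finset.mem_filter, Finset.mem_univ,
      true_and] at h1 h2
    obtain ⟨x, hx, rfl⟩ := h1
    obtain ⟨y, hy, hxy⟩ := h2
    have := hfix y x hy hxy.symm
    subst this
    exact hx hy
  rw [hU, Finset.prod_union hD, kmzW]
  congr 1
  · have key : ∀ c ∈ σ.cycleFactorsFinset, ∃ x, x ∈ c.support ∧ x ∈ σ.support ∧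
        σ.cycleOf x = c := by
      intro c hc
      have hc' := Equiv.Perm.mem_cycleFactorsFinset_iff.1 hc
      obtain ⟨x, hx⟩ := hc'.1.nonempty_support
      refine ⟨x, hx, Equiv.Perm.mem_cycleFactorsFinset_support_le hc hx, ?_⟩
      exact (Equiv.Perm.cycle_is_cycleOf hx hc).symm
    choose g hg1 hg2 hg3 using key
    refine Finset.prod_bij (fun c hc => f (g c hc)) ?_ ?_ ?_ ?_
    · intro c hc
      exact Finset.mem_image_of_mem _ (hg2 c hc)
    · intro c hc d hd h
      have := (hf _ _).1 h
      rw [← hg3 c hc, ← hg3 d hd]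
      exact this.cycleOf_eq
    · intro b hb
      obtain ⟨x, hx, rfl⟩ := Finset.mem_image.1 hb
      have hc : σ.cycleOf x ∈ σ.cycleFactorsFinset :=
        Equiv.Perm.cycleOf_mem_cycleFactorsFinset_iff.2 hx
      refine ⟨σ.cycleOf x, hc, ?_⟩
      rw [hf]
      have := hg1 _ hc
      rw [Equiv.Perm.mem_support_cycleOf_iff] at this
      exact this.1.symm
    · intro c hc
      congr 2
      ext y
      simp only [Finset.mem_filter, Finset.mem_univ, true_and]
      rw [hf]
      conv_lhs => rw [← hg3 c hc]
      rw [Equiv.Perm.mem_support_cycleOf_iff]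
      constructor
      · exact fun h => h.1.symm
      · exact fun h => ⟨h.symm, hg2 c hc⟩
  · rw [Finset.prod_image]
    · refine Finset.prod_congr rfl ?_
      intro x hx
      have hx : σ x = x := by simpa using hx
      have : Finset.univ.filter (fun j => f j = f x) = {x} := by
        ext y
        simp only [Finset.mem_filter, Finset.mem_univ, true_and, Finset.mem_singleton]
        exact ⟨hfix x y hx, fun h => by rw [h]⟩
      rw [this, Finset.sum_singleton]
    · intro x _ y hy h
      have hy : σ y = y := by simpa using hy
      exact hfix y x hy h

theorem sameCycle_imp {α : Type} (σ : Equiv.Perm α) (r : α → α → Prop) (hr : Equivalence r)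
    (h : ∀ x, r x (σ x)) {x y : α} (hxy : σ.SameCycle x y) : r x y := by
  obtain ⟨n, rfl⟩ := hxy
  induction n using Int.induction_on with
  | zero => exact hr.refl _
  | succ n ih =>
    refine hr.trans ih ?_
    have := h ((σ ^ (n : ℤ)) x)
    rwa [← Equiv.Perm.mul_apply, ← zpow_one_add, add_comm] at this
  | pred n ih =>
    refine hr.trans ih (hr.symm ?_)
    have := h ((σ ^ (-(n : ℤ) - 1)) x)
    rwa [← Equiv.Perm.mul_apply, ← zpow_one_add, add_sub_cancel] at this

/-- class function of a permutation -/
def cyc {α : Type} (σ : Equiv.Perm α) (x : α) : Set α := {y | σ.SameCycle x y}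

theorem cyc_iff {α : Type} (σ : Equiv.Perm α) (x y : α) :
    cyc σ x = cyc σ y ↔ σ.SameCycle x y := by
  constructor
  · intro h
    have : y ∈ cyc σ y := Equiv.Perm.SameCycle.refl _ _
    rw [← h] at this
    exact this
  · intro h
    ext z
    exact ⟨fun hz => h.symm.trans hz, fun hz => h.trans hz⟩

theorem kmzRR_equiv {α β : Type} [Fintype α] [DecidableEq α] [Fintype β] [DecidableEq β]
    (e : α ≃ β) (a : β → ℕ) : kmzRR α (a ∘ e) = kmzRR β a := by
  classical
  unfold kmzRR
  refine Fintype.sum_equiv e.permCongr _ _ ?_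
  intro σ
  rw [kmzW_eq σ (a ∘ e) (cyc σ) (cyc_iff σ),
    kmzW_eq (e.permCongr σ) a (cyc σ ∘ e.symm)]
  · have : Finset.univ.image (cyc σ ∘ e.symm) = Finset.univ.image (cyc σ) := by
      ext b
      simp only [Finset.mem_image, Finset.mem_univ, true_and, Function.comp]
      exact ⟨fun ⟨x, h⟩ => ⟨_, h⟩, fun ⟨x, h⟩ => ⟨e x, by simpa using h⟩⟩
    rw [this]
    refine Finset.prod_congr rfl fun b _ => ?_
    congr 1
    rw [Finset.sum_filter, Finset.sum_filter]
    refine Fintype.sum_equiv e _ _ ?_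
    intro x
    simp
  · intro x y
    simp only [Function.comp, cyc_iff]
    constructor
    · intro h
      have := sameCycle_imp σ (fun x y => (e.permCongr σ).SameCycle (e x) (e y))
        ⟨fun _ => .refl _ _, fun h => h.symm, fun h h' => h.trans h'⟩ (fun x => by
          refine ⟨1, ?_⟩
          simp [Equiv.permCongr_apply]) h
      simpa using this
    · intro h
      exact sameCycle_imp _ (fun x y => σ.SameCycle (e.symm x) (e.symm y))
        ⟨fun _ => .refl _ _, fun h => h.symm, fun h h' => h.trans h'⟩ (fun x => by
          refine ⟨1, ?_⟩
          simp [Equiv.permCongr_apply]) h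

theorem kmzW_none {α : Type} [Fintype α] [DecidableEq α] (σ : Equiv.Perm α)
    (a : Option α → ℕ) :
    kmzW (Equiv.Perm.decomposeOption.symm (none, σ)) a = X (a none) * kmzW σ (a ∘ some) := by
  classical
  rw [kmzW_eq σ _ (cyc σ) (cyc_iff σ), kmzW_eq _ a (Option.map (cyc σ))]
  · have : Finset.univ.image (Option.map (cyc σ)) =
        insert none ((Finset.univ.image (cyc σ)).image some) := by
      ext b
      simp only [Finset.mem_image, Finset.mem_univ, true_and, Finset.mem_insert]
      cases b <;> simp [Option.exists]
    rw [this, Finset.prod_insert (by simp), Finset.prod_image (by simp)]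
    congr 1
    · congr 1
      rw [Finset.sum_filter, Fintype.sum_option]
      simp
    · refine Finset.prod_congr rfl fun b _ => ?_
      congr 1
      rw [Finset.sum_filter, Fintype.sum_option, Finset.sum_filter]
      simp
  · set τ := Equiv.Perm.decomposeOption.symm (none, σ) with hτ
    have h0 : τ none = none := by simp [hτ]
    have h1 : ∀ x, τ (some x) = some (σ x) := by intro x; simp [hτ]
    intro x y
    constructor
    · intro h
      cases x with
      | none => cases y with
        | none => exact .refl _ _
        | some y => simp at h
      | some x => cases y with
        | none => simp at h
        | some y =>
          simp only [Option.map_some, Option.some.injEq, cyc_iff] at h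
          exact sameCycle_imp σ (fun x y => τ.SameCycle (some x) (some y))
            ⟨fun _ => .refl _ _, fun h => h.symm, fun h h' => h.trans h'⟩
            (fun x => ⟨1, by simp [h1]⟩) h
    · intro h
      refine sameCycle_imp τ (fun x y => Option.map (cyc σ) x = Option.map (cyc σ) y)
        ⟨fun _ => rfl, fun h => h.symm, fun h h' => h.trans h'⟩ ?_ h
      intro x
      cases x with
      | none => rw [h0]
      | some x =>
        rw [h1]
        simp only [Option.map_some, Option.some.injEq, cyc_iff]
        exact ⟨1, by simp⟩

theorem kmzW_some {α : Type} [Fintype α] [DecidableEq α] (σ : Equiv.Perm α) (i : α)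
    (a : Option α → ℕ) :
    kmzW (Equiv.Perm.decomposeOption.symm (some i, σ)) a =
      kmzW σ (a ∘ some + Pi.single i (a none)) := by
  classical
  rw [kmzW_eq σ _ (cyc σ) (cyc_iff σ), kmzW_eq _ a (fun x => cyc σ (x.getD i))]
  · have : Finset.univ.image (fun x : Option α => cyc σ (x.getD i)) =
        Finset.univ.image (cyc σ) := by
      ext b
      simp only [Finset.mem_image, Finset.mem_univ, true_and]
      exact ⟨fun ⟨x, h⟩ => ⟨_, h⟩, fun ⟨x, h⟩ => ⟨some x, by simpa using h⟩⟩
    rw [this]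
    refine Finset.prod_congr rfl fun b _ => ?_
    congr 1
    rw [Finset.sum_filter, Fintype.sum_option]
    simp only [Pi.add_apply, Finset.sum_add_distrib, Finset.sum_filter, Function.comp,
      Option.getD_some, Option.getD_none]
    rw [add_comm]
    congr 1
    rw [Finset.sum_eq_single i]
    · simp
    · intro j _ hj
      simp [Pi.single_eq_of_ne hj]
    · simp
  · set τ := Equiv.Perm.decomposeOption.symm (some i, σ) with hτ
    have h0 : τ none = some i := by simp [hτ]
    have h1 : ∀ x, τ (some x) = if σ x = i then none else some (σ x) := by
      intro x
      simp [hτ, Equiv.swap_apply_def]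
    intro x y
    rw [cyc_iff]
    have hn : ∀ x : Option α, τ.SameCycle x (some (x.getD i)) := by
      intro x
      cases x with
      | none => exact ⟨1, by simp [h0]⟩
      | some x => exact .refl _ _
    constructor
    · intro h
      refine (hn x).trans (Equiv.Perm.SameCycle.trans ?_ (hn y).symm)
      refine sameCycle_imp σ (fun x y => τ.SameCycle (some x) (some y))
            ⟨fun _ => .refl _ _, fun h => h.symm, fun h h' => h.trans h'⟩
            (fun x => ?_) h
      have h2 : τ.SameCycle (some x) (τ (some x)) := ⟨1, by simp⟩
      refine h2.trans ?_
      rw [h1]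
      split_ifs with hx
      · rw [hx]
        exact hn none
      · exact .refl _ _
    · intro h
      refine sameCycle_imp τ (fun x y => σ.SameCycle (x.getD i) (y.getD i))
        ⟨fun _ => .refl _ _, fun h => h.symm, fun h h' => h.trans h'⟩ ?_ h
      intro x
      cases x with
      | none => rw [h0]; exact .refl _ _
      | some x =>
        rw [h1]
        refine ⟨1, ?_⟩
        split_ifs with hx
        · simpa using hx
        · simp

theorem kmzRR_option {α : Type} [Fintype α] [DecidableEq α] (a : Option α → ℕ) :
    kmzRR (Option α) a = X (a none) * kmzRR α (a ∘ some) +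
      ∑ i, kmzRR α (a ∘ some + Pi.single i (a none)) := by
  have : kmzRR (Option α) a = ∑ x : Option α × Equiv.Perm α,
      kmzW (Equiv.Perm.decomposeOption.symm x) a :=
    (Fintype.sum_equiv Equiv.Perm.decomposeOption.symm _ _ fun _ => rfl).symm
  rw [this, Fintype.sum_prod_type, Fintype.sum_option]
  simp only [kmzW_none, kmzW_some, kmzRR, Finset.mul_sum]

theorem kmzR_succ (k : ℕ) (v : Fin (k + 1)) (a : Fin (k + 1) → ℕ) :
    kmzR (k + 1) a = X (a v) * kmzR k (a ∘ v.succAbove) +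
      ∑ i, kmzR k (a ∘ v.succAbove + Pi.single i (a v)) := by
  have h := kmzRR_option (a ∘ (finSuccEquiv' v).symm)
  rw [kmzRR_equiv] at h
  have e : (a ∘ (finSuccEquiv' v).symm) ∘ some = a ∘ v.succAbove := by
    ext x; simp
  rw [e] at h
  simp only [Function.comp_apply, finSuccEquiv'_symm_none] at h
  exact h

/-- push-forward of weights -/
def push {p k : ℕ} (f : Fin p → Fin k) (a : Fin p → ℕ) (i : Fin k) : ℕ := ∑ j with f j = i, a j

/-- sum over surjections -/
noncomputable def NN (p k : ℕ) (a : Fin p → ℕ) (G : (Fin k → ℕ) → MvPolynomial ℕ ℚ) :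
    MvPolynomial ℕ ℚ :=
  ∑ f : Fin p → Fin k, if Function.Surjective f then G (push f a) else 0

theorem push_cons {p k : ℕ} (v : Fin k) (g : Fin p → Fin k) (a : Fin (p + 1) → ℕ) :
    push (Fin.cons v g : Fin (p + 1) → Fin k) a =
      push g (fun j => a j.succ) + Pi.single v (a 0) := by
  ext i
  simp only [push, Pi.add_apply, Finset.sum_filter, Fin.sum_univ_succ, Fin.cons_zero,
    Fin.cons_succ]
  rw [add_comm]
  congr 1
  simp [Pi.single_apply, eq_comm]

theorem NN_succ (p k : ℕ) (a : Fin (p + 1) → ℕ) :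
    NN (p + 1) (k + 1) a (kmzR (k + 1)) =
      NN p (k + 1) (fun j => a j.succ) (fun b => ∑ v, kmzR (k + 1) (b + Pi.single v (a 0))) +
      (k + 1 : ℚ) • (X (a 0) * NN p k (fun j => a j.succ) (kmzR k) +
        NN p k (fun j => a j.succ) (fun b => ∑ v, kmzR k (b + Pi.single v (a 0)))) := by
  set a' : Fin p → ℕ := fun j => a j.succ with ha'
  have h1 : NN (p + 1) (k + 1) a (kmzR (k + 1)) =
      ∑ v : Fin (k + 1), ∑ g : Fin p → Fin (k + 1),
        if Function.Surjective (Fin.cons v g : Fin (p + 1) → Fin (k + 1)) then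
          kmzR (k + 1) (push g a' + Pi.single v (a 0)) else 0 := by
    unfold NN
    rw [← Fintype.sum_prod_type']
    symm
    refine Fintype.sum_equiv (Fin.consEquiv (fun _ => Fin (k + 1))) _ _ ?_
    rintro ⟨v, g⟩
    simp [Fin.consEquiv, push_cons, ha']
  have h2 : ∀ (v : Fin (k + 1)) (g : Fin p → Fin (k + 1)), Function.Surjective g →
      Function.Surjective (Fin.cons v g : Fin (p + 1) → Fin (k + 1)) := by
    intro v g hg i
    obtain ⟨j, hj⟩ := hg i
    exact ⟨j.succ, by simpa using hj⟩
  have h3 : ∀ v : Fin (k + 1), (∑ g : Fin p → Fin (k + 1),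
        if Function.Surjective (Fin.cons v g : Fin (p + 1) → Fin (k + 1)) then
          kmzR (k + 1) (push g a' + Pi.single v (a 0)) else 0) =
      (∑ g : Fin p → Fin (k + 1), if Function.Surjective g then
          kmzR (k + 1) (push g a' + Pi.single v (a 0)) else 0) +
      ∑ h : Fin p → Fin k, if Function.Surjective h then
          (X (a 0) * kmzR k (push h a') +
            ∑ i, kmzR k (push h a' + Pi.single i (a 0))) else 0 := by
    intro v
    have h4 : (∑ h : Fin p → Fin k, if Function.Surjective h then
          (X (a 0) * kmzR k (push h a') +
            ∑ i, kmzR k (push h a' + Pi.single i (a 0))) else 0) =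
        ∑ g : Fin p → Fin (k + 1),
          if Function.Surjective (Fin.cons v g : Fin (p + 1) → Fin (k + 1)) ∧
            ¬ Function.Surjective g then
          kmzR (k + 1) (push g a' + Pi.single v (a 0)) else 0 := by
      refine Fintype.sum_of_injective (fun h => v.succAbove ∘ h) ?_ _ _ ?_ ?_
      · exact fun h h' e => funext fun x => Fin.succAbove_right_injective (congrFun e x)
      · intro g hg
        rw [if_neg]
        rintro ⟨hs, hn⟩
        apply hg
        have hv : ∀ x, g x ≠ v := by
          intro x hx
          apply hn
          intro i
          obtain ⟨j, hj⟩ := hs i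
          induction j using Fin.cases with
          | zero => exact ⟨x, by rw [hx]; simpa using hj⟩
          | succ j => exact ⟨j, by simpa using hj⟩
        have : ∀ x, ∃ y, v.succAbove y = g x := fun x => Fin.exists_succAbove_eq (hv x)
        choose h hh using this
        exact ⟨h, funext hh⟩
      · intro h
        have hns : ¬ Function.Surjective (v.succAbove ∘ h) := by
          intro hs
          obtain ⟨x, hx⟩ := hs v
          exact Fin.succAbove_ne _ _ hx
        have hiff : Function.Surjective (Fin.cons v (v.succAbove ∘ h) :
            Fin (p + 1) → Fin (k + 1)) ↔ Function.Surjective h := by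
          constructor
          · intro hs i
            obtain ⟨j, hj⟩ := hs (v.succAbove i)
            induction j using Fin.cases with
            | zero => exact absurd hj.symm (Fin.succAbove_ne _ _)
            | succ j => exact ⟨j, by simpa using hj⟩
          · intro hs i
            by_cases hi : i = v
            · exact ⟨0, by simp [hi]⟩
            · obtain ⟨y, hy⟩ := Fin.exists_succAbove_eq hi
              obtain ⟨x, hx⟩ := hs y
              exact ⟨x.succ, by simp [hx, hy]⟩
        simp only [hns, hiff, not_false_eq_true, and_true]
        refine if_congr Iff.rfl ?_ rfl
        rw [kmzR_succ k v]
        have e1 : (push (v.succAbove ∘ h) a' + Pi.single v (a 0) : Fin (k + 1) → ℕ) v = a 0 := by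
          simp [push, Fin.succAbove_ne]
        have e2 : (push (v.succAbove ∘ h) a' + Pi.single v (a 0)) ∘ v.succAbove = push h a' := by
          ext i
          simp [push, Fin.succAbove_ne]
        rw [e1, e2]
    rw [h4, ← Finset.sum_add_distrib]
    refine Finset.sum_congr rfl fun g _ => ?_
    by_cases hg : Function.Surjective g
    · simp [hg, h2 v g hg]
    · simp [hg]
  rw [h1, Finset.sum_congr rfl fun v _ => h3 v, Finset.sum_add_distrib, Finset.sum_comm]
  congr 1
  · unfold NN
    refine Finset.sum_congr rfl fun g _ => ?_
    split_ifs <;> simp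
  · rw [Finset.sum_const, Finset.card_univ, Fintype.card_fin]
    unfold NN
    rw [Finset.mul_sum, ← Finset.sum_add_distrib]
    have : ((k : ℚ) + 1) = ((k + 1 : ℕ) : ℚ) := by push_cast; rfl
    rw [this, Nat.cast_smul_eq_nsmul]
    congr 1
    refine Finset.sum_congr rfl fun g _ => ?_
    split_ifs <;> simp

theorem NN_zero_of_lt (p : ℕ) (a : Fin p → ℕ) (G) : NN p (p + 1) a G = 0 := by
  unfold NN
  refine Finset.sum_eq_zero fun f _ => if_neg ?_
  intro hs
  have := Fintype.card_le_of_surjective f hs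
  simp at this

theorem NN_main (p : ℕ) (a : Fin p → ℕ) :
    ∑ k ∈ Finset.range (p + 1), ((-1 : ℚ) ^ (p + k) / (Nat.factorial k)) • NN p k a (kmzR k) =
      (∏ j, X (a j) : MvPolynomial ℕ ℚ) := by
  induction p with
  | zero =>
    have : Function.Surjective (default : Fin 0 → Fin 0) := fun x => x.elim0
    simp [NN, kmzR, Equiv.Perm.cycleFactorsFinset_eq_empty_iff.2, Function.Surjective]
  | succ p ih =>
    rw [Finset.sum_range_succ', Fin.prod_univ_succ, ← ih]
    have h0 : NN (p + 1) 0 a (kmzR 0) = 0 := by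
      unfold NN
      exact Finset.sum_eq_zero fun f _ => (f 0).elim0
    rw [h0, smul_zero, add_zero]
    set a' : Fin p → ℕ := fun j => a j.succ with ha'
    let M : ℕ → MvPolynomial ℕ ℚ := fun k =>
      ((-1 : ℚ) ^ (p + k) / (Nat.factorial k)) •
        NN p k a' (fun b => ∑ v, kmzR k (b + Pi.single v (a 0)))
    have key : ∀ k, ((-1 : ℚ) ^ (p + 1 + (k + 1)) / (Nat.factorial (k + 1))) •
        NN (p + 1) (k + 1) a (kmzR (k + 1)) =
        X (a 0) * (((-1 : ℚ) ^ (p + k) / (Nat.factorial k)) • NN p k a' (kmzR k)) +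
          (M k - M (k + 1)) := by
      intro k
      have hk : (k.factorial : ℚ) ≠ 0 := by positivity
      have hk1 : (k : ℚ) + 1 ≠ 0 := by positivity
      have c1 : ((-1 : ℚ) ^ (p + 1 + (k + 1)) / (Nat.factorial (k + 1))) * (k + 1) =
          (-1 : ℚ) ^ (p + k) / (Nat.factorial k) := by
        rw [Nat.factorial_succ]
        push_cast
        field_simp
        ring
      have c2 : ((-1 : ℚ) ^ (p + 1 + (k + 1)) / (Nat.factorial (k + 1))) =
          - ((-1 : ℚ) ^ (p + (k + 1)) / (Nat.factorial (k + 1))) := by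
        ring
      rw [NN_succ, smul_add, smul_smul, c1, c2, neg_smul, smul_add, mul_smul_comm]
      simp only [M]
      ring
    rw [Finset.sum_congr rfl fun k _ => key k, Finset.sum_add_distrib, Finset.sum_range_sub',
      ← Finset.mul_sum]
    have m0 : M 0 = 0 := by simp [M, NN]
    have m1 : M (p + 1) = 0 := by simp only [M, NN_zero_of_lt, smul_zero]
    rw [m0, m1, sub_zero, add_zero]

theorem NN_eq (p k : ℕ) (a : Fin p → ℕ) :
    (∑ S : Fin k → Finset (Fin p),
          if (∀ i, (S i).Nonempty) ∧ (∀ i j, i ≠ j → Disjoint (S i) (S j)) ∧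
              Finset.univ.biUnion S = Finset.univ then
            kmzR k (fun i => ∑ j ∈ S i, a j)
          else 0) = NN p k a (kmzR k) := by
  unfold NN
  symm
  refine Fintype.sum_of_injective (fun f i => Finset.univ.filter fun j => f j = i) ?_ _ _ ?_ ?_
  · intro f g h
    funext x
    have := congrFun h (f x)
    have h2 : x ∈ Finset.univ.filter fun j => f j = f x := by simp
    have h3 : x ∈ Finset.univ.filter fun j => g j = f x := by
      exact (Finset.ext_iff.1 this x).1 h2
    simpa using (Finset.mem_filter.1 h3).2.symm
  · intro S hS
    rw [if_neg]
    rintro ⟨_, hd, hu⟩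
    apply hS
    have : ∀ x, ∃ i, x ∈ S i := by
      intro x
      have : x ∈ Finset.univ.biUnion S := by rw [hu]; simp
      simpa using this
    choose f hf using this
    refine ⟨f, ?_⟩
    funext i
    ext x
    simp only [Finset.mem_filter, Finset.mem_univ, true_and]
    constructor
    · rintro rfl
      exact hf x
    · intro hx
      by_contra hne
      exact Finset.disjoint_left.1 (hd _ _ hne) (hf x) hx
  · intro f
    refine if_congr ?_ rfl rfl
    constructor
    · intro hs
      refine ⟨fun i => ?_, fun i j hij => ?_, ?_⟩
      · obtain ⟨x, hx⟩ := hs i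
        exact ⟨x, by simpa using hx⟩
      · rw [Finset.disjoint_left]
        intro x hx hy
        simp only [Finset.mem_filter, Finset.mem_univ, true_and] at hx hy
        exact hij (hx.symm.trans hy)
      · ext x
        simp
    · rintro ⟨h, _⟩ i
      obtain ⟨x, hx⟩ := h i
      exact ⟨x, by simpa using hx⟩

theorem kappa_prod_eq_R_inversion (p : ℕ) (hp : 0 < p) (a : Fin p → ℕ)
    (ha : ∀ j, 0 < a j) :
    (∏ j, X (a j) : MvPolynomial ℕ ℚ) =
      ∑ k ∈ Finset.Icc 1 p, ((-1 : ℚ) ^ (p - k) / (Nat.factorial k)) •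
        ∑ S : Fin k → Finset (Fin p),
          if (∀ i, (S i).Nonempty) ∧ (∀ i j, i ≠ j → Disjoint (S i) (S j)) ∧
              Finset.univ.biUnion S = Finset.univ then
            kmzR k (fun i => ∑ j ∈ S i, a j)
          else 0 := by
  rw [← NN_main]
  symm
  refine Finset.sum_subset_zero_on_sdiff ?_ ?_ ?_
  · intro k hk
    simp only [Finset.mem_Icc, Finset.mem_range] at hk ⊢
    omega
  · intro k hk
    simp only [Finset.mem_Icc, Finset.mem_range, Finset.mem_sdiff] at hk
    have : k = 0 := by omega
    subst this
    have : NN p 0 a (kmzR 0) = 0 := by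
      unfold NN
      exact Finset.sum_eq_zero fun f _ => (f ⟨0, hp⟩).elim0
    rw [this, smul_zero]
  · intro k hk
    simp only [Finset.mem_Icc] at hk
    rw [NN_eq]
    congr 2
    obtain ⟨m, rfl⟩ := Nat.exists_eq_add_of_le hk.2
    rw [Nat.add_sub_cancel_left, show k + m + k = m + 2 * k by ring, pow_add, pow_mul]
    simp
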